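/- Let û, Φ : ℝ × ℝ → ℝ be smooth functions of (x,t) solving the Gurevich-Zybin system û_t + û·û_x + Φ_x = 0 and ρ_t + ∂_x(û·ρ) = 0 where ρ = Φ_xx. Then at every point: ∂_t(ρ·û) + ∂_x(ρ·û² + Φ_x²/2) = 0. -/

import Mathlib

/-- Partial derivative with respect to the first variable `x`. -/
noncomputable def pdx (f : ℝ × ℝ → ℝ) (p : ℝ × ℝ) : ℝ := deriv (fun x => f (x, p.2)) p.1

/-- Partial derivative with respect to the second variable `t`. -/
noncomputable def pdt (f : ℝ × ℝ → ℝ) (p : ℝ × ℝ) : ℝ := deriv (fun t => f (p.1, t)) p.2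

theorem ContDiff.hasDerivAt_fst_section {f : ℝ × ℝ → ℝ} (hf : ContDiff ℝ (⊤ : ℕ∞) f)
    (p : ℝ × ℝ) : HasDerivAt (fun x => f (x, p.2)) (fderiv ℝ f p (1, 0)) p.1 :=
  ((hf.differentiable (by simp)) p).hasFDerivAt.comp_hasDerivAt p.1
    ((hasDerivAt_id p.1).prodMk (hasDerivAt_const p.1 p.2))

theorem ContDiff.hasDerivAt_snd_section {f : ℝ × ℝ → ℝ} (hf : ContDiff ℝ (⊤ : ℕ∞) f)
    (p : ℝ × ℝ) : HasDerivAt (fun t => f (p.1, t)) (fderiv ℝ f p (0, 1)) p.2 :=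
  ((hf.differentiable (by simp)) p).hasFDerivAt.comp_hasDerivAt p.2
    ((hasDerivAt_const p.2 p.1).prodMk (hasDerivAt_id p.2))

theorem ContDiff.hasDerivAt_pdx {f : ℝ × ℝ → ℝ} (hf : ContDiff ℝ (⊤ : ℕ∞) f) (p : ℝ × ℝ) :
    HasDerivAt (fun x => f (x, p.2)) (pdx f p) p.1 :=
  (hf.hasDerivAt_fst_section p).differentiableAt.hasDerivAt

theorem ContDiff.hasDerivAt_pdt {f : ℝ × ℝ → ℝ} (hf : ContDiff ℝ (⊤ : ℕ∞) f) (p : ℝ × ℝ) :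
    HasDerivAt (fun t => f (p.1, t)) (pdt f p) p.2 :=
  (hf.hasDerivAt_snd_section p).differentiableAt.hasDerivAt

theorem ContDiff.pdx {f : ℝ × ℝ → ℝ} (hf : ContDiff ℝ (⊤ : ℕ∞) f) :
    ContDiff ℝ (⊤ : ℕ∞) (pdx f) := by
  have h : _root_.pdx f = fun p => fderiv ℝ f p (1, 0) :=
    funext fun p => (hf.hasDerivAt_fst_section p).deriv
  rw [h]
  exact (hf.fderiv_right (by simp)).clm_apply contDiff_const

theorem gurevichZybin_momentum_conservation (uh Φ : ℝ × ℝ → ℝ)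
    (huh : ContDiff ℝ (⊤ : ℕ∞) uh) (hΦ : ContDiff ℝ (⊤ : ℕ∞) Φ)
    (hequ : ∀ p : ℝ × ℝ, pdt uh p + uh p * pdx uh p + pdx Φ p = 0)
    (heqρ : ∀ p : ℝ × ℝ,
      pdt (fun q => pdx (pdx Φ) q) p + pdx (fun q => uh q * pdx (pdx Φ) q) p = 0) :
    ∀ p : ℝ × ℝ,
      pdt (fun q => pdx (pdx Φ) q * uh q) p
        + pdx (fun q => pdx (pdx Φ) q * (uh q) ^ 2 + (pdx Φ q) ^ 2 / 2) p = 0 := by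
  intro p
  have hΦx := hΦ.pdx
  have hρ := hΦx.pdx
  have hflux : pdx (fun q => uh q * pdx (pdx Φ) q) p
      = pdx uh p * pdx (pdx Φ) p + uh p * pdx (pdx (pdx Φ)) p :=
    ((huh.hasDerivAt_pdx p).mul (hρ.hasDerivAt_pdx p)).deriv
  have hdensity : pdt (fun q => pdx (pdx Φ) q * uh q) p
      = pdt (pdx (pdx Φ)) p * uh p + pdx (pdx Φ) p * pdt uh p :=
    ((hρ.hasDerivAt_pdt p).mul (huh.hasDerivAt_pdt p)).deriv
  have hmomentum := (((hρ.hasDerivAt_pdx p).mul ((huh.hasDerivAt_pdx p).pow 2)).add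
    (((hΦx.hasDerivAt_pdx p).pow 2).div_const 2)).deriv
  change pdx (fun q => pdx (pdx Φ) q * (uh q) ^ 2 + (pdx Φ q) ^ 2 / 2) p = _ at hmomentum
  have hcont := heqρ p
  rw [hflux] at hcont
  rw [hdensity, hmomentum]
  simp only [Pi.pow_apply, Prod.mk.eta]
  push_cast
  linear_combination uh p * hcont + pdx (pdx Φ) p * hequ p
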